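/- arXiv:2604.08429 — 3 statements merged into one kernel-verified Lean document; each statement's English description precedes it below -/
import Mathlib

section
/- Let k be a commutative ring, let N, n, c ∈ ℕ, and let f_1, …, f_c ∈ k[x_1, …, x_N]. Set A = k[x_1, …, x_N]/(f_1, …, f_c) and J = k[x_i^{(q)} : 1 ≤ i ≤ N, 0 ≤ q ≤ n]/(f_j^{(q)} : 1 ≤ j ≤ c, 0 ≤ q ≤ n). Then J corepresents the functor of n-jets of A: for every commutative k-algebra B there is a bijection Hom_{k-alg}(J, B) ≅ Hom_{k-alg}(A, B[t]/(t^{n+1})), natural in B (i.e., compatible with composition with any k-algebra homomorphism B → B'). -/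
/-!
Statement 0: the Hasse–Schmidt presentation of the `n`-th jet algebra corepresents the
functor of `n`-jets.
-/

universe u

noncomputable section

namespace JetPresentation

variable (k : Type u) [CommRing k]

/-- The truncated polynomial algebra `B[t]/(t^{n+1})`. -/
abbrev TruncPoly (B : Type u) [CommRing B] (n : ℕ) : Type u :=
  Polynomial B ⧸ Ideal.span {(Polynomial.X : Polynomial B) ^ (n + 1)}

/-- The `k`-algebra map `B[t]/(t^{n+1}) → B'[t]/(t^{n+1})` induced by a `k`-algebra map
`g : B → B'`. -/
def truncPolyMap {B B' : Type u} [CommRing B] [CommRing B'] [Algebra k B] [Algebra k B']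
    (n : ℕ) (g : B →ₐ[k] B') : TruncPoly B n →ₐ[k] TruncPoly B' n :=
  Ideal.Quotient.liftₐ _ ((Ideal.Quotient.mkₐ k _).comp (Polynomial.mapAlgHom g))
    (by
      intro a ha
      rw [Ideal.mem_span_singleton] at ha
      obtain ⟨c, rfl⟩ := ha
      have hX : Polynomial.mapAlgHom g (Polynomial.X : Polynomial B) = Polynomial.X := by
        simp [Polynomial.mapAlgHom]
      have h0 : Ideal.Quotient.mkₐ k
          (Ideal.span {(Polynomial.X : Polynomial B') ^ (n + 1)})
          ((Polynomial.X : Polynomial B') ^ (n + 1)) = 0 := by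
        rw [Ideal.Quotient.mkₐ_eq_mk, Ideal.Quotient.eq_zero_iff_mem]
        exact Ideal.subset_span rfl
      rw [AlgHom.comp_apply, map_mul, map_pow, hX, map_mul, map_pow, ← map_pow, h0,
        zero_mul])

variable (N n : ℕ)

/-- The universal Hasse–Schmidt expansion: the `k`-algebra map
`k[x_1,…,x_N] → k[x_i^{(q)}][t]` sending `x_i ↦ Σ_{q=0}^{n} x_i^{(q)} t^q`. -/
def hsExpansion :
    MvPolynomial (Fin N) k →ₐ[k] Polynomial (MvPolynomial (Fin N × Fin (n + 1)) k) :=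
  MvPolynomial.aeval fun i : Fin N =>
    ∑ q : Fin (n + 1), Polynomial.C (MvPolynomial.X (i, q)) * Polynomial.X ^ (q : ℕ)

/-- The `q`-th Hasse–Schmidt derivative `g^{(q)} ∈ k[x_i^{(q)} : 1 ≤ i ≤ N, 0 ≤ q ≤ n]`
of `g ∈ k[x_1,…,x_N]`: the coefficient of `t^q` in `Φ_n(g)`. -/
def hsDeriv (g : MvPolynomial (Fin N) k) (q : ℕ) : MvPolynomial (Fin N × Fin (n + 1)) k :=
  (hsExpansion k N n g).coeff q

end JetPresentation

end

namespace JetPresentation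

theorem mk_eq_zero_iff_coeff {B : Type u} [CommRing B] (n : ℕ) (p : Polynomial B) :
    Ideal.Quotient.mk (Ideal.span {(Polynomial.X : Polynomial B) ^ (n + 1)}) p = 0 ↔
      ∀ q : Fin (n + 1), p.coeff q = 0 := by
  rw [Ideal.Quotient.eq_zero_iff_mem, Ideal.mem_span_singleton, Polynomial.X_pow_dvd_iff]
  exact ⟨fun h q => h q q.2, fun h d hd => h ⟨d, hd⟩⟩

/-- The jet of the affine space attached to a map out of the polynomial ring. -/
noncomputable def preJet (k : Type u) [CommRing k] (N n : ℕ) {B : Type u} [CommRing B]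
    [Algebra k B] (φ : MvPolynomial (Fin N × Fin (n + 1)) k →ₐ[k] B) :
    MvPolynomial (Fin N) k →ₐ[k] TruncPoly B n :=
  (Ideal.Quotient.mkₐ k _).comp ((Polynomial.mapAlgHom φ).comp (hsExpansion k N n))

theorem preJet_apply (k : Type u) [CommRing k] (N n : ℕ) {B : Type u} [CommRing B]
    [Algebra k B] (φ : MvPolynomial (Fin N × Fin (n + 1)) k →ₐ[k] B)
    (g : MvPolynomial (Fin N) k) :
    preJet k N n φ g = Ideal.Quotient.mk _ ((hsExpansion k N n g).map (φ : _ →+* B)) := rfl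

theorem preJet_eq_zero_iff (k : Type u) [CommRing k] (N n : ℕ) {B : Type u} [CommRing B]
    [Algebra k B] (φ : MvPolynomial (Fin N × Fin (n + 1)) k →ₐ[k] B)
    (g : MvPolynomial (Fin N) k) :
    preJet k N n φ g = 0 ↔ ∀ q : Fin (n + 1), φ (hsDeriv k N n g q) = 0 := by
  rw [preJet_apply, mk_eq_zero_iff_coeff]
  simp [hsDeriv, Polynomial.coeff_map]

theorem preJet_X (k : Type u) [CommRing k] (N n : ℕ) {B : Type u} [CommRing B]
    [Algebra k B] (φ : MvPolynomial (Fin N × Fin (n + 1)) k →ₐ[k] B) (i : Fin N) :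
    preJet k N n φ (MvPolynomial.X i) = Ideal.Quotient.mk _
      (∑ q : Fin (n + 1), Polynomial.C (φ (MvPolynomial.X (i, q))) * Polynomial.X ^ (q : ℕ)) := by
  rw [preJet_apply]
  simp [hsExpansion, Polynomial.map_sum]

theorem coeff_sum_fin {B : Type u} [CommRing B] (n : ℕ) (b : Fin (n + 1) → B)
    (q : Fin (n + 1)) :
    (∑ r : Fin (n + 1), Polynomial.C (b r) * Polynomial.X ^ (r : ℕ)).coeff q = b q := by
  simp [Polynomial.coeff_X_pow, Fin.val_inj]

theorem preJet_injective (k : Type u) [CommRing k] (N n : ℕ) {B : Type u} [CommRing B]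
    [Algebra k B] : Function.Injective (preJet k N n (B := B)) := by
  intro φ ψ h
  ext ⟨i, q⟩
  have h1 := DFunLike.congr_fun h (MvPolynomial.X i)
  rw [preJet_X, preJet_X, ← sub_eq_zero, ← map_sub, mk_eq_zero_iff_coeff] at h1
  have h2 := h1 q
  rwa [Polynomial.coeff_sub, coeff_sum_fin n (fun r => φ (MvPolynomial.X (i, r))),
    coeff_sum_fin n (fun r => ψ (MvPolynomial.X (i, r))), sub_eq_zero] at h2

theorem preJet_surjective (k : Type u) [CommRing k] (N n : ℕ) {B : Type u} [CommRing B]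
    [Algebra k B] : Function.Surjective (preJet k N n (B := B)) := by
  intro χ
  choose p hp using fun i : Fin N => Ideal.Quotient.mk_surjective (χ (MvPolynomial.X i))
  refine ⟨MvPolynomial.aeval fun iq => (p iq.1).coeff iq.2, ?_⟩
  ext i
  rw [preJet_X, ← hp i, ← sub_eq_zero, ← map_sub, mk_eq_zero_iff_coeff]
  intro q
  simp only [MvPolynomial.aeval_X]
  rw [Polynomial.coeff_sub, coeff_sum_fin n (fun r => (p i).coeff r), sub_self]

theorem preJet_comp (k : Type u) [CommRing k] (N n : ℕ) {B B' : Type u} [CommRing B]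
    [Algebra k B] [CommRing B'] [Algebra k B'] (g : B →ₐ[k] B')
    (φ : MvPolynomial (Fin N × Fin (n + 1)) k →ₐ[k] B) (a : MvPolynomial (Fin N) k) :
    preJet k N n (g.comp φ) a = truncPolyMap k n g (preJet k N n φ a) := by
  rw [preJet_apply, preJet_apply]
  change _ = Ideal.Quotient.mk _ (Polynomial.map (g : B →+* B') _)
  rw [Polynomial.map_map]
  rfl

/-- The ideal of the jet presentation. -/
noncomputable abbrev jetIdeal (k : Type u) [CommRing k] (N n c : ℕ)
    (f : Fin c → MvPolynomial (Fin N) k) : Ideal (MvPolynomial (Fin N × Fin (n + 1)) k) :=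
  Ideal.span (Set.range fun p : Fin c × Fin (n + 1) => hsDeriv k N n (f p.1) (p.2 : ℕ))

/-- The jet attached to a map out of the jet algebra. -/
noncomputable def toJet (k : Type u) [CommRing k] (N n c : ℕ)
    (f : Fin c → MvPolynomial (Fin N) k) {B : Type u} [CommRing B] [Algebra k B]
    (h : (MvPolynomial (Fin N × Fin (n + 1)) k ⧸ jetIdeal k N n c f) →ₐ[k] B) :
    (MvPolynomial (Fin N) k ⧸ Ideal.span (Set.range f)) →ₐ[k] TruncPoly B n :=
  Ideal.Quotient.liftₐ _ (preJet k N n (h.comp (Ideal.Quotient.mkₐ k _))) (by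
    suffices hle : Ideal.span (Set.range f) ≤
        RingHom.ker (preJet k N n (h.comp (Ideal.Quotient.mkₐ k (jetIdeal k N n c f)))) from
      fun a ha => hle ha
    rw [Ideal.span_le]
    rintro _ ⟨j, rfl⟩
    refine (preJet_eq_zero_iff k N n _ _).2 fun q => ?_
    have h0 : Ideal.Quotient.mk (jetIdeal k N n c f) (hsDeriv k N n (f j) q) = 0 :=
      Ideal.Quotient.eq_zero_iff_mem.2 (Ideal.subset_span ⟨(j, q), rfl⟩)
    rw [AlgHom.comp_apply, Ideal.Quotient.mkₐ_eq_mk, h0, map_zero])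

theorem toJet_mk (k : Type u) [CommRing k] (N n c : ℕ)
    (f : Fin c → MvPolynomial (Fin N) k) {B : Type u} [CommRing B] [Algebra k B]
    (h : (MvPolynomial (Fin N × Fin (n + 1)) k ⧸ jetIdeal k N n c f) →ₐ[k] B)
    (a : MvPolynomial (Fin N) k) :
    toJet k N n c f h (Ideal.Quotient.mk _ a) =
      preJet k N n (h.comp (Ideal.Quotient.mkₐ k _)) a := rfl

theorem toJet_bijective (k : Type u) [CommRing k] (N n c : ℕ)
    (f : Fin c → MvPolynomial (Fin N) k) (B : Type u) [CommRing B] [Algebra k B] :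
    Function.Bijective (toJet k N n c f (B := B)) := by
  constructor
  · intro h h' hh
    apply Ideal.Quotient.algHom_ext
    apply preJet_injective
    apply AlgHom.ext
    intro a
    rw [← toJet_mk, ← toJet_mk, hh]
  · intro χ
    obtain ⟨φ, hφ⟩ := preJet_surjective k N n (χ.comp (Ideal.Quotient.mkₐ k _))
    have hle : jetIdeal k N n c f ≤ RingHom.ker φ := by
      rw [Ideal.span_le]
      rintro _ ⟨⟨j, q⟩, rfl⟩
      refine (preJet_eq_zero_iff k N n φ (f j)).1 ?_ q
      have h0 : Ideal.Quotient.mk (Ideal.span (Set.range f)) (f j) = 0 :=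
        Ideal.Quotient.eq_zero_iff_mem.2 (Ideal.subset_span ⟨j, rfl⟩)
      rw [hφ, AlgHom.comp_apply, Ideal.Quotient.mkₐ_eq_mk, h0, map_zero]
    refine ⟨Ideal.Quotient.liftₐ _ φ fun a ha => hle ha, ?_⟩
    apply AlgHom.ext
    intro a
    obtain ⟨a, rfl⟩ := Ideal.Quotient.mk_surjective a
    rw [toJet_mk]
    change preJet k N n φ a = _
    rw [hφ]
    rfl

end JetPresentation

open JetPresentation

/-- Let `k` be a commutative ring, `N, n, c ∈ ℕ`, and
`f_1, …, f_c ∈ k[x_1,…,x_N]`. Set `A = k[x_1,…,x_N]/(f_1,…,f_c)` and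
`J = k[x_i^{(q)}]/(f_j^{(q)} : 1 ≤ j ≤ c, 0 ≤ q ≤ n)`. Then `J` corepresents the functor
of `n`-jets of `A`: for every commutative `k`-algebra `B` there is a bijection
`Hom_{k-alg}(J, B) ≅ Hom_{k-alg}(A, B[t]/(t^{n+1}))`, natural in `B`. -/
theorem jet_presentation_corepresents (k : Type u) [CommRing k] (N n c : ℕ)
    (f : Fin c → MvPolynomial (Fin N) k) :
    ∃ e : ∀ (B : Type u) [CommRing B] [Algebra k B],
        ((MvPolynomial (Fin N × Fin (n + 1)) k ⧸
            Ideal.span (Set.range fun p : Fin c × Fin (n + 1) =>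
              hsDeriv k N n (f p.1) (p.2 : ℕ))) →ₐ[k] B) ≃
        ((MvPolynomial (Fin N) k ⧸ Ideal.span (Set.range f)) →ₐ[k] TruncPoly B n),
      ∀ (B B' : Type u) [CommRing B] [Algebra k B] [CommRing B'] [Algebra k B']
        (g : B →ₐ[k] B')
        (h : (MvPolynomial (Fin N × Fin (n + 1)) k ⧸
            Ideal.span (Set.range fun p : Fin c × Fin (n + 1) =>
              hsDeriv k N n (f p.1) (p.2 : ℕ))) →ₐ[k] B),
        e B' (g.comp h) = (truncPolyMap k n g).comp (e B h) := by
  refine ⟨fun B _ _ => Equiv.ofBijective _ (toJet_bijective k N n c f B), ?_⟩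
  intro B B' _ _ _ _ g h
  apply AlgHom.ext
  intro a
  obtain ⟨a, rfl⟩ := Ideal.Quotient.mk_surjective a
  exact preJet_comp k N n g (h.comp (Ideal.Quotient.mkₐ k _)) a
end

section
/- Let K be a field and R = K⟦t⟧. Every chain complex C of finitely generated free R-modules indexed by ℕ is isomorphic, as a complex of R-modules, to a direct sum, with finitely many summands in each degree, of complexes of the two forms F(i) (i ∈ ℕ) and E(i, a) (i, a ∈ ℕ). -/
/-!
Preliminaries for statements about complexes of finitely generated free modules over
`R = K⟦t⟧`: ℕ-indexed chain complexes, the elementary complexes `F(i)` and `E(i,a)`,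
their direct sums, homology, and tensoring with `R/(t^{n+1})`.
-/

universe u

noncomputable section

namespace TorsionComplex

variable {R : Type u} [CommRing R]

/-- A chain complex of `R`-modules indexed by `ℕ` (homological indexing):
modules `X i` and differentials `d i : X (i+1) → X i` with `d ∘ d = 0`. -/
structure NatComplex (R : Type u) [CommRing R] : Type (u + 1) where
  X : ℕ → Type u
  [acg : ∀ i, AddCommGroup (X i)]
  [mod : ∀ i, Module R (X i)]
  d : ∀ i, X (i + 1) →ₗ[R] X i
  dd : ∀ i, (d i).comp (d (i + 1)) = 0

attribute [instance] NatComplex.acg NatComplex.mod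

/-- An isomorphism of ℕ-indexed chain complexes of `R`-modules. -/
structure ComplexIso (C D : NatComplex R) where
  e : ∀ i, C.X i ≃ₗ[R] D.X i
  comm : ∀ i x, e i (C.d i x) = D.d i (e (i + 1) x)

/-- A morphism of ℕ-indexed chain complexes of `R`-modules. -/
structure ComplexHom (C D : NatComplex R) where
  f : ∀ i, C.X i →ₗ[R] D.X i
  comm : ∀ i x, f i (C.d i x) = D.d i (f (i + 1) x)

/-- The cycles in degree `i`: all of `X 0` in degree `0`, and the kernel of the
outgoing differential `X (i+1) → X i` in degree `i+1`. -/
def cycles (C : NatComplex R) : ∀ i, Submodule R (C.X i)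
  | 0 => ⊤
  | (i + 1) => LinearMap.ker (C.d i)

/-- The boundaries in degree `i`: the range of `d i : X (i+1) → X i`. -/
def boundaries (C : NatComplex R) (i : ℕ) : Submodule R (C.X i) :=
  LinearMap.range (C.d i)

/-- The `i`-th homology of an ℕ-indexed chain complex: cycles modulo boundaries. -/
abbrev homology (C : NatComplex R) (i : ℕ) : Type u :=
  (cycles C i) ⧸ (Submodule.comap (cycles C i).subtype (boundaries C i))

theorem mapsTo_cycles {C D : NatComplex R} (φ : ComplexHom C D) (i : ℕ) :
    ∀ x ∈ cycles C i, φ.f i x ∈ cycles D i := by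
  intro x hx
  cases i with
  | zero => trivial
  | succ i =>
    simp only [cycles, LinearMap.mem_ker] at hx ⊢
    rw [← φ.comm i, hx, map_zero]

/-- The map on homology induced by a morphism of complexes. -/
def ComplexHom.homologyMap {C D : NatComplex R} (φ : ComplexHom C D) (i : ℕ) :
    homology C i →ₗ[R] homology D i :=
  Submodule.mapQ _ _ ((φ.f i).restrict (mapsTo_cycles φ i))
    (by
      rintro ⟨x, hx⟩ hmem
      simp only [Submodule.mem_comap, boundaries] at hmem ⊢
      obtain ⟨y, hy⟩ := hmem
      exact ⟨φ.f (i + 1) y, by simp [LinearMap.restrict_apply, ← φ.comm i, hy]⟩)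

end TorsionComplex

end

noncomputable section

namespace TorsionComplex

/-- `prevNat c` is the shift of `c`: `prevNat c 0 = 0`, `prevNat c (i+1) = c i`
(used to encode quantities indexed by `i − 1`, with the convention `c_{−1} = 0`). -/
def prevNat (c : ℕ → ℕ) : ℕ → ℕ
  | 0 => 0
  | (i + 1) => c i

/-- `prevA a` shifts a doubly-indexed family: `prevA a (i+1) = a i` (and the empty family
in degree `0`). -/
def prevA {c : ℕ → ℕ} (a : ∀ i, Fin (c i) → ℕ) : ∀ i, Fin (prevNat c i) → ℕ
  | 0 => Fin.elim0
  | (i + 1) => a i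

variable (K : Type u) [Field K]

/-- Degree-`i` term of the direct sum `(⊕_j F(j)^{b_j}) ⊕ (⊕_j ⊕_{l<c_j} E(j, a_{j,l}))`:
`F(j)` contributes a copy of `R` in degree `j`, and `E(j,a)` contributes a copy of `R` in
degrees `j+1` and `j`. -/
abbrev stdX (b c : ℕ → ℕ) (i : ℕ) : Type u :=
  (Fin (b i) → PowerSeries K) × (Fin (c i) → PowerSeries K) ×
    (Fin (prevNat c i) → PowerSeries K)

/-- Differential of the standard complex: on the summand `E(i, a_{i,j})` it is
multiplication by `t^{a_{i,j}}` from degree `i+1` to degree `i`; it vanishes on the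
summands `F(i)`. -/
def stdD (b c : ℕ → ℕ) (a : ∀ i, Fin (c i) → ℕ) (i : ℕ) :
    stdX K b c (i + 1) →ₗ[PowerSeries K] stdX K b c i :=
  LinearMap.prod 0 (LinearMap.prod
    ((LinearMap.pi fun j : Fin (c i) =>
        (PowerSeries.X : PowerSeries K) ^ (a i j) • LinearMap.proj j).comp
      ((LinearMap.snd _ _ _).comp (LinearMap.snd _ _ _)))
    0)

/-- The direct sum, with finitely many summands in each degree, of the elementary
complexes `F(i)` (a copy of `R` in degree `i`), with multiplicity `b i`, and
`E(i, a i j)` (copies of `R` in degrees `i+1` and `i`, with differential multiplication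
by `t^{a i j}`), for `j : Fin (c i)`. -/
def stdComplex (b c : ℕ → ℕ) (a : ∀ i, Fin (c i) → ℕ) : NatComplex (PowerSeries K) where
  X := stdX K b c
  d := stdD K b c a
  dd i := by
    apply LinearMap.ext
    intro x
    simp [stdD, LinearMap.prod_apply]

end TorsionComplex

end

noncomputable section

namespace TorsionComplex

variable (K : Type u) [Field K]

/-- The quotient module `R/(t^m)`, `R = K⟦t⟧`. -/
abbrev qmod (m : ℕ) : Type u :=
  PowerSeries K ⧸ Ideal.span {(PowerSeries.X : PowerSeries K) ^ m}

/-- The complex `C ⊗_R R/(t^m)`, obtained by applying `− ⊗_R R/(t^m)` degreewise. -/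
def tensorQ (C : NatComplex (PowerSeries K)) (m : ℕ) : NatComplex (PowerSeries K) where
  X i := TensorProduct (PowerSeries K) (C.X i) (qmod K m)
  d i := LinearMap.rTensor _ (C.d i)
  dd i := by
    rw [← LinearMap.rTensor_comp, C.dd, LinearMap.rTensor_zero]

/-- The `R`-linear map `R/(t^{n+1}) → R/(t^{m+1})`, `x ↦ t^{m−n}·x`. -/
def qmodShift (n m : ℕ) (hnm : n ≤ m) : qmod K (n + 1) →ₗ[PowerSeries K] qmod K (m + 1) :=
  Submodule.liftQ _
    ((PowerSeries.X : PowerSeries K) ^ (m - n) •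
      (Ideal.span {(PowerSeries.X : PowerSeries K) ^ (m + 1)}).mkQ)
    (by
      rw [Ideal.span_le, Set.singleton_subset_iff]
      have : ((PowerSeries.X : PowerSeries K) ^ (m - n) •
            (Ideal.span {(PowerSeries.X : PowerSeries K) ^ (m + 1)}).mkQ)
            ((PowerSeries.X : PowerSeries K) ^ (n + 1))
          = Submodule.Quotient.mk ((PowerSeries.X : PowerSeries K) ^ (m + 1)) := by
        rw [LinearMap.smul_apply, Submodule.mkQ_apply, ← Submodule.Quotient.mk_smul,
          smul_eq_mul, ← pow_add]
        congr 2
        omega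
      simp only [SetLike.mem_coe, LinearMap.mem_ker, this, Submodule.Quotient.mk_eq_zero]
      exact Ideal.subset_span rfl)

end TorsionComplex

end

noncomputable section

namespace TorsionComplex

variable (K : Type u) [Field K]

/-- The map of complexes `ψ_{n,m} : C ⊗_R R/(t^{n+1}) → C ⊗_R R/(t^{m+1})` induced
degreewise by `R/(t^{n+1}) → R/(t^{m+1})`, `x ↦ t^{m−n}·x`. -/
def tensorShift (C : NatComplex (PowerSeries K)) (n m : ℕ) (hnm : n ≤ m) :
    ComplexHom (tensorQ K C (n + 1)) (tensorQ K C (m + 1)) where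
  f i := LinearMap.lTensor (C.X i) (qmodShift K n m hnm)
  comm i x := by
    show (LinearMap.lTensor (C.X i) (qmodShift K n m hnm)).comp
        (LinearMap.rTensor (qmod K (n+1)) (C.d i)) x
      = ((LinearMap.rTensor (qmod K (m+1)) (C.d i)).comp
        (LinearMap.lTensor (C.X (i+1)) (qmodShift K n m hnm))) x
    rw [LinearMap.lTensor_comp_rTensor, LinearMap.rTensor_comp_lTensor]

end TorsionComplex

end

open TorsionComplex

/-- Splitting off a surjection onto a projective module. -/
theorem split_surj {R : Type*} [CommRing R] {M P : Type*} [AddCommGroup M] [Module R M]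
    [AddCommGroup P] [Module R P] [Module.Projective R P] (g : M →ₗ[R] P)
    (hg : Function.Surjective g) (Z : Submodule R M) (hZ : LinearMap.ker g = Z) :
    ∃ E : M ≃ₗ[R] Z × P, (∀ x, (E x).2 = g x) ∧ ∀ z : Z, E (z : M) = (z, 0) := by
  subst hZ
  obtain ⟨s, hs⟩ := Module.projective_lifting_property g LinearMap.id hg
  have hs' : ∀ y, g (s y) = y := fun y => LinearMap.congr_fun hs y
  let f : M →ₗ[R] LinearMap.ker g :=
    LinearMap.codRestrict _ (LinearMap.id - s.comp g) (fun x => by simp [hs'])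
  refine ⟨LinearEquiv.ofLinearMap (f.prod g) ((LinearMap.ker g).subtype.coprod s) ?_ ?_, ?_, ?_⟩
  · apply LinearMap.ext
    rintro ⟨⟨z, hz⟩, p⟩
    rw [LinearMap.mem_ker] at hz
    ext <;> simp [f, hs', hz]
  · ext x
    simp [f]
  · intro x
    simp
  · rintro ⟨z, hz⟩
    rw [LinearMap.mem_ker] at hz
    ext <;> simp [f, hz]

/-- Smith normal form over `K⟦t⟧` for a map into a finite free module. -/
theorem smith_map (K : Type u) [Field K] {M Z : Type u} [AddCommGroup M]
    [Module (PowerSeries K) M] [AddCommGroup Z] [Module (PowerSeries K) Z]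
    [Module.Free (PowerSeries K) Z] [Module.Finite (PowerSeries K) Z]
    (φ : M →ₗ[PowerSeries K] Z) :
    ∃ (b c : ℕ) (a : Fin c → ℕ)
      (e : Z ≃ₗ[PowerSeries K] (Fin b → PowerSeries K) × (Fin c → PowerSeries K))
      (g : M →ₗ[PowerSeries K] (Fin c → PowerSeries K)),
      Function.Surjective g ∧ LinearMap.ker g = LinearMap.ker φ ∧
      ∀ x, e (φ x) = (0, fun j => (PowerSeries.X : PowerSeries K) ^ a j * g x j) := by
  classical
  obtain ⟨c, bM, bN, f, q, hq⟩ := (LinearMap.range φ).smithNormalForm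
    (Module.Free.chooseBasis (PowerSeries K) Z)
  have hq0 : ∀ j, q j ≠ 0 := by
    intro j hj
    apply bN.ne_zero j
    apply Subtype.ext
    simp [hq, hj]
  choose a u hu using fun j => IsDiscreteValuationRing.eq_unit_mul_pow_irreducible (hq0 j)
    (PowerSeries.X_irreducible (R := K))
  let bN' := bN.unitsSMul (fun j => (u j)⁻¹)
  have hbN' : ∀ j, ((bN' j : LinearMap.range φ) : Z)
      = (PowerSeries.X : PowerSeries K) ^ a j • bM (f j) := by
    intro j
    simp only [bN', Module.Basis.unitsSMul_apply, Submodule.coe_smul_of_tower, hq, hu j]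
    rw [mul_smul, Units.smul_def, smul_smul, Units.inv_mul, one_smul]
  let r := Fintype.equivFin ((Set.range f)ᶜ : Set _)
  let B := bM.reindex ((Equiv.sumComm _ _).trans
    (((Equiv.ofInjective f f.injective).sumCongr r.symm).trans
    (Equiv.Set.sumCompl (Set.range f)))).symm
  have hB : ∀ j, B (Sum.inr j) = bM (f j) := by
    intro j
    simp [B]
  let e := B.equivFun.trans (LinearEquiv.sumArrowLequivProdArrow _ _ (PowerSeries K) _)
  refine ⟨_, c, a, e, bN'.equivFun.toLinearMap.comp φ.rangeRestrict, ?_, ?_, ?_⟩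
  · exact bN'.equivFun.surjective.comp φ.surjective_rangeRestrict
  · rw [LinearEquiv.ker_comp, LinearMap.ker_rangeRestrict]
  · intro x
    have key : φ x = ∑ j, (bN'.equivFun (φ.rangeRestrict x) j *
        (PowerSeries.X : PowerSeries K) ^ a j) • B (Sum.inr j) := by
      have h := congrArg Subtype.val (bN'.sum_equivFun (φ.rangeRestrict x))
      change _ = φ x at h
      rw [← h, Submodule.coe_sum]
      refine Finset.sum_congr rfl fun j _ => ?_
      rw [Submodule.coe_smul, hbN', hB, smul_smul]
    have key2 : B.equivFun (φ x) = Sum.elim (fun _ => 0)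
        (fun j => (PowerSeries.X : PowerSeries K) ^ a j * bN'.equivFun (φ.rangeRestrict x) j) := by
      rw [← LinearEquiv.eq_symm_apply, Module.Basis.equivFun_symm_apply, key]
      simp [Fintype.sum_sum_type, mul_comm]
    simp only [e, LinearEquiv.trans_apply, key2]
    ext j : 2 <;> simp

/-- Let `K` be a field and `R = K⟦t⟧`. Every chain complex `C` of
finitely generated free `R`-modules indexed by `ℕ` is isomorphic, as a complex of
`R`-modules, to a direct sum, with finitely many summands in each degree, of complexes of
the two forms `F(i)` (`R` in degree `i`) and `E(i, a)` (`R` in degrees `i+1` and `i`,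
with differential multiplication by `t^a`) — i.e. to `stdComplex K b c a` for some
multiplicities `b c : ℕ → ℕ` and exponents `a`. -/
theorem complex_decomposition (K : Type u) [Field K] (C : NatComplex (PowerSeries K))
    (hfree : ∀ i, Module.Free (PowerSeries K) (C.X i))
    (hfin : ∀ i, Module.Finite (PowerSeries K) (C.X i)) :
    ∃ (b c : ℕ → ℕ) (a : ∀ i, Fin (c i) → ℕ),
      Nonempty (ComplexIso C (stdComplex K b c a)) := by
  have hfz : ∀ i, Module.Free (PowerSeries K) (cycles C i) := fun i => inferInstance
  have hfinz : ∀ i, Module.Finite (PowerSeries K) (cycles C i) := fun i => inferInstance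
  have hmem : ∀ i x, C.d i x ∈ cycles C i := by
    intro i x
    cases i with
    | zero => trivial
    | succ i => exact LinearMap.congr_fun (C.dd i) x
  let φ : ∀ i, C.X (i + 1) →ₗ[PowerSeries K] cycles C i := fun i =>
    LinearMap.codRestrict _ (C.d i) (hmem i)
  choose b c a eZ g hgs hgk hge using fun i => smith_map K (φ i)
  let G : ∀ i, C.X i →ₗ[PowerSeries K] (Fin (prevNat c i) → PowerSeries K) := fun i =>
    match i with
    | 0 => 0
    | i + 1 => g i
  have hGs : ∀ i, Function.Surjective (G i) := by
    intro i
    cases i with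
    | zero => exact fun y => ⟨0, funext fun j => Fin.elim0 j⟩
    | succ i => exact hgs i
  have hGk : ∀ i, LinearMap.ker (G i) = cycles C i := by
    intro i
    cases i with
    | zero => exact LinearMap.ker_zero
    | succ i => exact (hgk i).trans (LinearMap.ker_codRestrict _ _ _)
  choose E hE1 hE2 using fun i => split_surj (G i) (hGs i) (cycles C i) (hGk i)
  refine ⟨b, c, a, ⟨⟨fun i => ((E i).trans ((eZ i).prodCongr (LinearEquiv.refl _ _))).trans
    (LinearEquiv.prodAssoc _ _ _ _), ?_⟩⟩⟩
  intro i x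
  have h1 : E i (C.d i x) = (φ i x, 0) := hE2 i (φ i x)
  have h2 : (E (i + 1) x).2 = g i x := hE1 (i + 1) x
  change LinearEquiv.prodAssoc (PowerSeries K) (Fin (b i) → PowerSeries K)
    (Fin (c i) → PowerSeries K) (Fin (prevNat c i) → PowerSeries K) (eZ i (E i (C.d i x)).1, (E i (C.d i x)).2) =
    ((0 : Fin (b i) → PowerSeries K), (fun j : Fin (c i) =>
      (PowerSeries.X : PowerSeries K) ^ (a i j) • (E (i + 1) x).2 j),
      (0 : Fin (prevNat c i) → PowerSeries K))
  rw [h1, h2, hge]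
  rfl
end

section
/- Let K be a field, R = K⟦t⟧, and let C be a chain complex of finitely generated free R-modules indexed by ℕ which is isomorphic, as a complex of R-modules, to (⊕_i F(i)^{⊕ b_i}) ⊕ (⊕_i ⊕_{j=1}^{c_i} E(i, a_{i,j})) with b_i, c_i ∈ ℕ and all a_{i,j} ≥ 1. Fix i ∈ ℕ and n ∈ ℕ such that a_{i,j} ≤ n+1 for all 1 ≤ j ≤ c_i and, if i ≥ 1, a_{i−1,j} ≤ n+1 for all 1 ≤ j ≤ c_{i−1}. Then H_i(C ⊗_R R/(t^{n+1})) ≅ (R/(t^{n+1}))^{b_i} ⊕ (⊕_{j=1}^{c_i} R/(t^{a_{i,j}})) ⊕ (⊕_{j=1}^{c_{i−1}} R/(t^{a_{i−1,j}})) (the last summand absent when i = 0); in particular its dimension as a K-vector space equals (n+1)·b_i + Σ_{j=1}^{c_i} a_{i,j} + Σ_{j=1}^{c_{i−1}} a_{i−1,j}. -/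
/-!
Preliminaries for statements about complexes of finitely generated free modules over
`R = K⟦t⟧`: ℕ-indexed chain complexes, the elementary complexes `F(i)` and `E(i,a)`,
their direct sums, homology, and tensoring with `R/(t^{n+1})`.
-/

universe u

namespace TorsionComplex

theorem cycles_iff_of_iso {R : Type u} [CommRing R] {C D : NatComplex R} (φ : ComplexIso C D)
    (i : ℕ) (x : C.X i) : φ.e i x ∈ cycles D i ↔ x ∈ cycles C i := by
  cases i with
  | zero => simp [cycles]
  | succ i =>
    simp only [cycles, LinearMap.mem_ker]
    rw [← φ.comm i]
    simp

theorem boundaries_iff_of_iso {R : Type u} [CommRing R] {C D : NatComplex R} (φ : ComplexIso C D)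
    (i : ℕ) (x : C.X i) : φ.e i x ∈ boundaries D i ↔ x ∈ boundaries C i := by
  constructor
  · rintro ⟨y, hy⟩
    refine ⟨(φ.e (i+1)).symm y, ?_⟩
    apply (φ.e i).injective
    rw [φ.comm, LinearEquiv.apply_symm_apply, hy]
  · rintro ⟨y, hy⟩
    exact ⟨φ.e (i+1) y, by rw [← φ.comm, hy]⟩

/-- A surjection from the cycles of an isomorphic complex, with kernel the boundaries,
computes homology. -/
theorem homology_equiv_of_iso {R : Type u} [CommRing R] {C D : NatComplex R}
    (φ : ComplexIso C D) (i : ℕ) {T : Type u} [AddCommGroup T] [Module R T]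
    (p : cycles D i →ₗ[R] T) (hp : Function.Surjective p)
    (hk : ∀ x, p x = 0 ↔ (x : D.X i) ∈ boundaries D i) :
    Nonempty (homology C i ≃ₗ[R] T) := by
  let r : cycles C i →ₗ[R] cycles D i :=
    (φ.e i).toLinearMap.restrict (fun x hx => (cycles_iff_of_iso φ i x).2 hx)
  have hr : ∀ x, ((r x : cycles D i) : D.X i) = φ.e i x := fun x => rfl
  have hs : Function.Surjective (p.comp r) := by
    intro t
    obtain ⟨⟨y, hy⟩, rfl⟩ := hp t
    refine ⟨⟨(φ.e i).symm y, ?_⟩, ?_⟩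
    · rw [← cycles_iff_of_iso φ i]; simpa using hy
    · simp only [LinearMap.comp_apply]
      congr 1
      apply Subtype.ext
      rw [hr]; simp
  have hker : Submodule.comap (cycles C i).subtype (boundaries C i) = LinearMap.ker (p.comp r) := by
    ext x
    rw [LinearMap.mem_ker, LinearMap.comp_apply, hk, hr, boundaries_iff_of_iso]
    rfl
  exact ⟨(Submodule.quotEquivOfEq _ _ hker).trans (LinearMap.quotKerEquivOfSurjective _ hs)⟩

/-- The truncated standard complex. -/
noncomputable def qstd (K : Type u) [Field K] (b c : ℕ → ℕ) (a : ∀ i, Fin (c i) → ℕ) (m : ℕ) :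
    NatComplex (PowerSeries K) where
  X i := (Fin (b i) → qmod K m) × (Fin (c i) → qmod K m) × (Fin (prevNat c i) → qmod K m)
  d i := LinearMap.prod 0 (LinearMap.prod
    ((LinearMap.pi fun j : Fin (c i) =>
        (PowerSeries.X : PowerSeries K) ^ (a i j) • LinearMap.proj j).comp
      ((LinearMap.snd _ _ _).comp (LinearMap.snd _ _ _)))
    0)
  dd i := by
    apply LinearMap.ext
    intro x
    simp [LinearMap.prod_apply]

noncomputable def piTensor (R : Type u) [CommRing R] (N : Type u) [AddCommGroup N] [Module R N]
    (k : ℕ) : TensorProduct R (Fin k → R) N ≃ₗ[R] (Fin k → N) :=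
  (TensorProduct.comm R _ _).trans (TensorProduct.piScalarRight R R N (Fin k))

theorem piTensor_tmul (R : Type u) [CommRing R] (N : Type u) [AddCommGroup N] [Module R N]
    (k : ℕ) (f : Fin k → R) (n : N) : piTensor R N k (TensorProduct.tmul R f n) =
      fun j => f j • n := by
  simp [piTensor]

noncomputable def prodTensor (R : Type u) [CommRing R] (N : Type u) [AddCommGroup N] [Module R N]
    (k l m : ℕ) : TensorProduct R ((Fin k → R) × (Fin l → R) × (Fin m → R)) N ≃ₗ[R]
      (Fin k → N) × (Fin l → N) × (Fin m → N) :=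
  (TensorProduct.prodLeft R R _ _ N).trans
    ((piTensor R N k).prodCongr ((TensorProduct.prodLeft R R _ _ N).trans
      ((piTensor R N l).prodCongr (piTensor R N m))))

theorem prodTensor_tmul (R : Type u) [CommRing R] (N : Type u) [AddCommGroup N] [Module R N]
    (k l m : ℕ) (f : (Fin k → R) × (Fin l → R) × (Fin m → R)) (n : N) :
    prodTensor R N k l m (TensorProduct.tmul R f n) =
      (fun j => f.1 j • n, fun j => f.2.1 j • n, fun j => f.2.2 j • n) := by
  obtain ⟨f, g, h⟩ := f
  simp [prodTensor, piTensor_tmul]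

noncomputable def tensorIso (K : Type u) [Field K] (b c : ℕ → ℕ) (a : ∀ i, Fin (c i) → ℕ) (m : ℕ)
    (C : NatComplex (PowerSeries K)) (φ : ComplexIso C (stdComplex K b c a)) :
    ComplexIso (tensorQ K C m) (qstd K b c a m) where
  e i := (LinearEquiv.rTensor (qmod K m) (φ.e i)).trans
    (prodTensor (PowerSeries K) (qmod K m) (b i) (c i) (prevNat c i))
  comm i x := by
    let E := fun i => (LinearEquiv.rTensor (qmod K m) (φ.e i)).trans
      (prodTensor (PowerSeries K) (qmod K m) (b i) (c i) (prevNat c i))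
    have key : (E i).toLinearMap.comp (LinearMap.rTensor (qmod K m) (C.d i)) =
        ((qstd K b c a m).d i).comp (E (i + 1)).toLinearMap := by
      apply TensorProduct.ext'
      intro x q
      have h2 : ∀ i (y : C.X i), E i (TensorProduct.tmul _ y q) =
        prodTensor (PowerSeries K) (qmod K m) (b i) (c i)
            (prevNat c i) (TensorProduct.tmul _ (φ.e i y) q) := fun i y => rfl
      change E i (TensorProduct.tmul _ (C.d i x) q) =
        (qstd K b c a m).d i (E (i + 1) (TensorProduct.tmul _ x q))
      erw [h2, h2]
      rw [φ.comm]
      erw [prodTensor_tmul, prodTensor_tmul]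
      generalize φ.e (i+1) x = y
      obtain ⟨y1, y2, y3⟩ := y
      refine Prod.ext ?_ (Prod.ext ?_ ?_)
      · funext j
        exact zero_smul _ _
      · funext j
        exact mul_smul _ _ _
      · funext j
        exact zero_smul _ _
    exact LinearMap.congr_fun key x

theorem mem_cycles_qstd (K : Type u) [Field K] (b c : ℕ → ℕ) (a : ∀ i, Fin (c i) → ℕ) (m i : ℕ)
    (x : (qstd K b c a m).X i) : x ∈ cycles (qstd K b c a m) i ↔
      ∀ j, (PowerSeries.X : PowerSeries K) ^ (prevA a i j) • x.2.2 j = 0 := by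
  cases i with
  | zero => 
    simp only [cycles, Submodule.mem_top, true_iff]
    exact fun j => j.elim0
  | succ i =>
    simp only [cycles, LinearMap.mem_ker]
    constructor
    · intro h j
      exact congrFun (congrArg (fun y => y.2.1) h) j
    · intro h
      exact Prod.ext rfl (Prod.ext (funext h) rfl)

theorem mem_boundaries_qstd (K : Type u) [Field K] (b c : ℕ → ℕ) (a : ∀ i, Fin (c i) → ℕ) (m i : ℕ)
    (x : (qstd K b c a m).X i) : x ∈ boundaries (qstd K b c a m) i ↔
      x.1 = 0 ∧ (∀ j, ∃ y, (PowerSeries.X : PowerSeries K) ^ (a i j) • y = x.2.1 j)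
        ∧ x.2.2 = 0 := by
  constructor
  · rintro ⟨y, rfl⟩
    exact ⟨rfl, fun j => ⟨y.2.2 j, rfl⟩, rfl⟩
  · rintro ⟨h1, h2, h3⟩
    choose y hy using h2
    exact ⟨(0, 0, y), Prod.ext h1.symm (Prod.ext (funext hy) h3.symm)⟩

/-- Projection `R/(t^m) → R/(t^k)` for `k ≤ m`. -/
noncomputable def qproj (K : Type u) [Field K] (m k : ℕ) (h : k ≤ m) :
    qmod K m →ₗ[PowerSeries K] qmod K k :=
  Submodule.factor (p := Ideal.span {(PowerSeries.X : PowerSeries K) ^ m})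
    (p' := Ideal.span {(PowerSeries.X : PowerSeries K) ^ k})
    (Ideal.span_singleton_le_span_singleton.2 (pow_dvd_pow _ h))

theorem qproj_surj (K : Type u) [Field K] (m k : ℕ) (h : k ≤ m) :
    Function.Surjective (qproj K m k h) := 
  Submodule.factor_surjective (Ideal.span_singleton_le_span_singleton.2 (pow_dvd_pow _ h))

theorem qproj_eq_zero (K : Type u) [Field K] (m k : ℕ) (h : k ≤ m) (x : qmod K m) :
    qproj K m k h x = 0 ↔ ∃ y : qmod K m, (PowerSeries.X : PowerSeries K) ^ k • y = x := by
  obtain ⟨x, rfl⟩ := Submodule.Quotient.mk_surjective _ x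
  have : qproj K m k h (Submodule.Quotient.mk x) = Submodule.Quotient.mk x := rfl
  rw [this, Submodule.Quotient.mk_eq_zero, Ideal.mem_span_singleton]
  constructor
  · rintro ⟨y, rfl⟩
    exact ⟨Submodule.Quotient.mk y, rfl⟩
  · rintro ⟨y, hy⟩
    obtain ⟨y, rfl⟩ := Submodule.Quotient.mk_surjective _ y
    rw [← Submodule.Quotient.mk_smul, Submodule.Quotient.eq, Ideal.mem_span_singleton,
      smul_eq_mul] at hy
    have h3 := (pow_dvd_pow _ h).trans hy
    exact (dvd_sub_right (dvd_mul_right _ _)).1 h3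

/-- Multiplication `R/(t^k) → ker (t^k | R/(t^m))`, by `t^(m-k)`. -/
noncomputable def qinc (K : Type u) [Field K] (m k : ℕ) (h : k ≤ m) :
    qmod K k →ₗ[PowerSeries K]
      LinearMap.ker (LinearMap.lsmul (PowerSeries K) (qmod K m) (PowerSeries.X ^ k)) :=
  Submodule.liftQ _ (LinearMap.codRestrict _
    ((PowerSeries.X : PowerSeries K) ^ (m - k) • (Ideal.span {(PowerSeries.X : PowerSeries K) ^ m}).mkQ)
    (by
      intro x
      rw [LinearMap.mem_ker, LinearMap.lsmul_apply, LinearMap.smul_apply, smul_smul, ← pow_add,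
        Nat.add_sub_cancel' h, Submodule.mkQ_apply, ← Submodule.Quotient.mk_smul,
        Submodule.Quotient.mk_eq_zero, Ideal.mem_span_singleton]
      exact dvd_mul_right _ _))
    (by
      rw [Ideal.span_le, Set.singleton_subset_iff, SetLike.mem_coe, LinearMap.mem_ker]
      apply Subtype.ext
      rw [LinearMap.codRestrict_apply, LinearMap.smul_apply, Submodule.mkQ_apply,
        ← Submodule.Quotient.mk_smul, smul_eq_mul, ← pow_add, Nat.sub_add_cancel h]
      exact (Submodule.Quotient.mk_eq_zero _).2 (Ideal.mem_span_singleton_self _))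

theorem qinc_mk (K : Type u) [Field K] (m k : ℕ) (h : k ≤ m) (x : PowerSeries K) :
    (qinc K m k h (Submodule.Quotient.mk x) : qmod K m) =
      Submodule.Quotient.mk (PowerSeries.X ^ (m - k) * x) := rfl

theorem qinc_bij (K : Type u) [Field K] (m k : ℕ) (h : k ≤ m) :
    Function.Bijective (qinc K m k h) := by
  have hX : ∀ l, (PowerSeries.X : PowerSeries K) ^ l ≠ 0 := fun l =>
    pow_ne_zero _ PowerSeries.X_ne_zero
  constructor
  · rw [injective_iff_map_eq_zero]
    intro x hx
    obtain ⟨x, rfl⟩ := Submodule.Quotient.mk_surjective _ x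
    have hx := congrArg Subtype.val hx
    rw [qinc_mk] at hx
    have hx := (Submodule.Quotient.mk_eq_zero _).1 hx
    rw [Ideal.mem_span_singleton] at hx
    rw [Submodule.Quotient.mk_eq_zero, Ideal.mem_span_singleton]
    have e : (PowerSeries.X : PowerSeries K) ^ m = PowerSeries.X ^ (m - k) * PowerSeries.X ^ k := by
      rw [← pow_add, Nat.sub_add_cancel h]
    rw [e] at hx
    exact (mul_dvd_mul_iff_left (hX _)).1 hx
  · rintro ⟨y, hy⟩
    obtain ⟨y, rfl⟩ := Submodule.Quotient.mk_surjective _ y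
    rw [LinearMap.mem_ker, LinearMap.lsmul_apply, ← Submodule.Quotient.mk_smul,
        Submodule.Quotient.mk_eq_zero, Ideal.mem_span_singleton, smul_eq_mul] at hy
    have e : (PowerSeries.X : PowerSeries K) ^ m = PowerSeries.X ^ k * PowerSeries.X ^ (m - k) := by
      rw [← pow_add, Nat.add_sub_cancel' h]
    rw [e] at hy
    obtain ⟨z, rfl⟩ := (mul_dvd_mul_iff_left (hX _)).1 hy
    exact ⟨Submodule.Quotient.mk z, Subtype.ext (qinc_mk ..)⟩

noncomputable def qincEquiv (K : Type u) [Field K] (m k : ℕ) (h : k ≤ m) :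
    qmod K k ≃ₗ[PowerSeries K]
      LinearMap.ker (LinearMap.lsmul (PowerSeries K) (qmod K m) (PowerSeries.X ^ k)) :=
  LinearEquiv.ofBijective _ (qinc_bij K m k h)

theorem homology_part (K : Type u) [Field K]
    (C : NatComplex (PowerSeries K)) (b c : ℕ → ℕ) (a : ∀ i, Fin (c i) → ℕ)
    (φ : ComplexIso C (stdComplex K b c a))
    (i m : ℕ)
    (hbound : ∀ j : Fin (c i), a i j ≤ m)
    (hbound' : ∀ j : Fin (prevNat c i), prevA a i j ≤ m) :
    Nonempty (homology (tensorQ K C m) i ≃ₗ[PowerSeries K]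
      ((Fin (b i) → qmod K m) × (∀ j : Fin (c i), qmod K (a i j)) ×
        (∀ j : Fin (prevNat c i), qmod K (prevA a i j)))) := by
  let p3 : ∀ j : Fin (prevNat c i), cycles (qstd K b c a m) i →ₗ[PowerSeries K]
      LinearMap.ker (LinearMap.lsmul (PowerSeries K) (qmod K m) (PowerSeries.X ^ prevA a i j)) :=
    fun j => LinearMap.codRestrict _
      (((LinearMap.proj j).comp ((LinearMap.snd _ _ _).comp (LinearMap.snd (PowerSeries K)
        (Fin (b i) → qmod K m) ((Fin (c i) → qmod K m) × (Fin (prevNat c i) → qmod K m))))).comp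
        (cycles (qstd K b c a m) i).subtype)
      (fun x => (mem_cycles_qstd K b c a m i x.1).1 x.2 j)
  let p2 : ∀ j : Fin (c i), cycles (qstd K b c a m) i →ₗ[PowerSeries K] qmod K (a i j) :=
    fun j => (qproj K m (a i j) (hbound j)).comp
      (((LinearMap.proj j).comp ((LinearMap.fst _ _ _).comp (LinearMap.snd (PowerSeries K)
        (Fin (b i) → qmod K m) ((Fin (c i) → qmod K m) × (Fin (prevNat c i) → qmod K m))))).comp
        (cycles (qstd K b c a m) i).subtype)
  let p1 : cycles (qstd K b c a m) i →ₗ[PowerSeries K] (Fin (b i) → qmod K m) :=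
      (LinearMap.fst (PowerSeries K)
        (Fin (b i) → qmod K m) ((Fin (c i) → qmod K m) × (Fin (prevNat c i) → qmod K m))).comp
        (cycles (qstd K b c a m) i).subtype
  let p := p1.prod ((LinearMap.pi p2).prod (LinearMap.pi fun j =>
    (qincEquiv K m (prevA a i j) (hbound' j)).symm.toLinearMap.comp (p3 j)))
  refine homology_equiv_of_iso (tensorIso K b c a m C φ) i p ?_ ?_
  · rintro ⟨x, y, z⟩
    choose y' hy' using fun j => qproj_surj K m (a i j) (hbound j) (y j)
    let z' : ∀ j, _ := fun j => qincEquiv K m (prevA a i j) (hbound' j) (z j)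
    refine ⟨⟨(x, y', fun j => (z' j).1), ?_⟩, ?_⟩
    · exact (mem_cycles_qstd K b c a m i _).2 fun j => (z' j).2
    · refine Prod.ext rfl (Prod.ext (funext hy') (funext fun j => ?_))
      exact (qincEquiv K m (prevA a i j) (hbound' j)).symm_apply_apply (z j)
  · intro x
    rw [mem_boundaries_qstd]
    have h1 : p x = 0 ↔ (p1 x = 0 ∧ (∀ j, p2 j x = 0) ∧
        ∀ j, (qincEquiv K m (prevA a i j) (hbound' j)).symm (p3 j x) = 0) := by
      simp only [Prod.ext_iff, funext_iff]
      rfl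
    rw [h1]
    refine and_congr Iff.rfl (and_congr (forall_congr' fun j => ?_) ?_)
    · exact qproj_eq_zero K m (a i j) (hbound j) _
    · simp only [LinearEquiv.map_eq_zero_iff]
      rw [funext_iff]
      exact forall_congr' fun j => Subtype.ext_iff

theorem qmod_equiv (K : Type u) [Field K] (m : ℕ) : Nonempty (qmod K m ≃ₗ[K] (Fin m → K)) := by
  let f : PowerSeries K →ₗ[K] (Fin m → K) := LinearMap.pi fun j => PowerSeries.coeff (j : ℕ)
  have hf : Function.Surjective f := by
    intro v
    refine ⟨PowerSeries.mk fun n => if h : n < m then v ⟨n, h⟩ else 0, ?_⟩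
    funext j
    simp [f]
  have hk : (Ideal.span {(PowerSeries.X : PowerSeries K) ^ m}).restrictScalars K
      = LinearMap.ker f := by
    ext x
    rw [Submodule.restrictScalars_mem, Ideal.mem_span_singleton, PowerSeries.X_pow_dvd_iff,
      LinearMap.mem_ker, funext_iff]
    exact ⟨fun h j => h j j.2, fun h k hk => h ⟨k, hk⟩⟩
  exact ⟨(Submodule.Quotient.restrictScalarsEquiv K _).symm.trans
    ((Submodule.quotEquivOfEq _ _ hk).trans (LinearMap.quotKerEquivOfSurjective f hf))⟩

instance qmod_finite (K : Type u) [Field K] (m : ℕ) : Module.Finite K (qmod K m) :=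
  Module.Finite.equiv (qmod_equiv K m).some.symm

theorem qmod_finrank (K : Type u) [Field K] (m : ℕ) : Module.finrank K (qmod K m) = m := by
  rw [(qmod_equiv K m).some.finrank_eq]; simp

theorem finrank_restrict (K : Type u) [Field K] (M T : Type u) [AddCommGroup M]
    [Module (PowerSeries K) M] [AddCommGroup T] [Module (PowerSeries K) T] [Module K T]
    [IsScalarTower K (PowerSeries K) T] (e : M ≃ₗ[PowerSeries K] T) :
    Module.finrank K (RestrictScalars K (PowerSeries K) M) = Module.finrank K T := by
  let e' : RestrictScalars K (PowerSeries K) M ≃ₗ[K] T :=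
    { (RestrictScalars.addEquiv K (PowerSeries K) M).trans e.toAddEquiv with
      map_smul' := by
        intro k x
        have : RestrictScalars.addEquiv K (PowerSeries K) M (k • x) =
          algebraMap K (PowerSeries K) k • RestrictScalars.addEquiv K (PowerSeries K) M x := rfl
        change e (RestrictScalars.addEquiv K (PowerSeries K) M (k • x)) =
          k • e (RestrictScalars.addEquiv K (PowerSeries K) M x)
        rw [this, map_smul, algebraMap_smul] }
  exact e'.finrank_eq

end TorsionComplex

open TorsionComplex

/-- Let `K` be a field, `R = K⟦t⟧`, and let `C` be a chain complex of
finitely generated free `R`-modules isomorphic to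
`(⊕_i F(i)^{b_i}) ⊕ (⊕_i ⊕_{j<c_i} E(i, a_{i,j}))` with all `a_{i,j} ≥ 1`. Fix `i, n`
with `a_{i,j} ≤ n+1` and `a_{i−1,j} ≤ n+1` for all `j`. Then
`H_i(C ⊗_R R/(t^{n+1})) ≅ (R/(t^{n+1}))^{b_i} ⊕ (⊕_j R/(t^{a_{i,j}})) ⊕
(⊕_j R/(t^{a_{i−1,j}}))` (last summand absent for `i = 0`), of `K`-dimension
`(n+1)·b_i + Σ_j a_{i,j} + Σ_j a_{i−1,j}`. -/
theorem homology_of_truncated_complex (K : Type u) [Field K]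
    (C : NatComplex (PowerSeries K)) (b c : ℕ → ℕ) (a : ∀ i, Fin (c i) → ℕ)
    (hpos : ∀ i j, 1 ≤ a i j)
    (hiso : Nonempty (ComplexIso C (stdComplex K b c a)))
    (i n : ℕ)
    (hbound : ∀ j : Fin (c i), a i j ≤ n + 1)
    (hbound' : ∀ j : Fin (prevNat c i), prevA a i j ≤ n + 1) :
    Nonempty (homology (tensorQ K C (n + 1)) i ≃ₗ[PowerSeries K]
      ((Fin (b i) → qmod K (n + 1)) × (∀ j : Fin (c i), qmod K (a i j)) ×
        (∀ j : Fin (prevNat c i), qmod K (prevA a i j)))) ∧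
    Module.finrank K
        (RestrictScalars K (PowerSeries K) (homology (tensorQ K C (n + 1)) i))
      = (n + 1) * b i + (∑ j : Fin (c i), a i j) +
        (∑ j : Fin (prevNat c i), prevA a i j) := by
  obtain ⟨φ⟩ := hiso
  obtain ⟨e⟩ := homology_part K C b c a φ i (n + 1) hbound hbound'
  refine ⟨⟨e⟩, ?_⟩
  rw [finrank_restrict K _ _ e, Module.finrank_prod, Module.finrank_prod,
    Module.finrank_pi_fintype, Module.finrank_pi_fintype, Module.finrank_pi_fintype]
  simp only [qmod_finrank]
  simp only [Finset.sum_const, Finset.card_univ, Fintype.card_fin, smul_eq_mul]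
  ring
end
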